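/- Let 0 < α < 1, let I ⊆ ℝ be an open interval, f : I → (0,∞) smooth, β ∈ I, λ₁ ∈ ℝ, λ₂ ∈ ℝ with λ₂ ≠ 0, suppose ω_{λ₁}(x) > 0 for all x ∈ I and g(x) = λ₂ √(f(x))/ω_{λ₁}(x) + f'(x)/2, and let a, c ∈ ℝ. Define for z > 0: φ(z) = H^{2,0}_{1,2}[z^{−2α}/4 | (1,2α); (1/2−a/2, 1), (−(a+λ₂)/2, 1)] and ψ(z) = H^{2,0}_{1,2}[z^{−2α}/4 | (1,2α); (−a/2, 1), (1/2−(a+λ₂)/2, 1)]. Then u(x,t) = (c/√(f(x))) ω_{λ₁}(x)^a φ(ω_{λ₁}(x)^{−1/α} t) and v(x,t) = −c ω_{λ₁}(x)^a ψ(ω_{λ₁}(x)^{−1/α} t) satisfy ∂^α_t u = ∂_x v and ∂^α_t v = f(x) ∂_x u + g(x) u on I × (0,∞). -/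

import Mathlib

open MeasureTheory Real Set

noncomputable section

/-- The Riemann–Liouville kernel: for `α = n` it is `h` itself; for `n - 1 < α < n`
it is the fractional integral of order `n - α` of `h`. -/
def rlKernel (n : ℕ) (α : ℝ) (h : ℝ → ℝ) : ℝ → ℝ :=
  if α = (n : ℝ) then h
  else fun t => (Real.Gamma ((n : ℝ) - α))⁻¹ *
    ∫ s in (0:ℝ)..t, h s * (t - s) ^ ((n : ℝ) - α - 1)

/-- The Riemann–Liouville fractional derivative of order `α` (with `n - 1 < α ≤ n`). -/
def rlDeriv (n : ℕ) (α : ℝ) (h : ℝ → ℝ) : ℝ → ℝ :=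
  iteratedDeriv n (rlKernel n α h)

/-- The Riemann–Liouville derivative of order `α` of `h` exists on `(0, ∞)`. -/
def HasRLDerivOn (n : ℕ) (α : ℝ) (h : ℝ → ℝ) : Prop :=
  ContDiffOn ℝ n (rlKernel n α h) (Set.Ioi 0)

/-- The Fox H-function `H^{2,0}_{1,2}[w | (1,2α); (b₁,1), (b₂,1)]` for `w > 0`,
defined via the Mellin–Barnes integral along the vertical line `Re = γ`
(with `γ < min b₁ b₂`):
`(1/2π) ∫_ℝ Γ(b₁−(γ+is)) Γ(b₂−(γ+is)) / Γ(1−2α(γ+is)) · w^{γ+is} ds`. -/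
def foxH2012 (α b₁ b₂ γ w : ℝ) : ℝ :=
  (1 / (2 * Real.pi)) *
    (∫ s : ℝ,
      Complex.Gamma ((b₁ : ℂ) - ((γ : ℂ) + (s : ℂ) * Complex.I)) *
        Complex.Gamma ((b₂ : ℂ) - ((γ : ℂ) + (s : ℂ) * Complex.I)) /
        Complex.Gamma (1 - 2 * (α : ℂ) * ((γ : ℂ) + (s : ℂ) * Complex.I)) *
        (w : ℂ) ^ ((γ : ℂ) + (s : ℂ) * Complex.I)).re

theorem integral_cpow_mul_exp_neg_complex_mul_Ioi {z r : ℂ} (hz : 0 < z.re) (hr : 0 < r.re) :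
    ∫ t : ℝ in Ioi 0, (t : ℂ) ^ (z - 1) * Complex.exp (-(r * t)) =
      (1 / r) ^ z * Complex.Gamma z := by
  set U : Set ℂ := {r | 0 < r.re} with hUdef
  have hU : IsOpen U := isOpen_lt continuous_const Complex.continuous_re
  have hpow : ContinuousOn (fun t : ℝ => (t : ℂ) ^ (z - 1)) (Ioi 0) := by
    intro t (ht : 0 < t)
    exact (Complex.continuousAt_ofReal_cpow_const t (z - 1) (Or.inr ht.ne')).continuousWithinAt
  have hcont : ∀ r : ℂ, ContinuousOn
      (fun t : ℝ => (t : ℂ) ^ (z - 1) * Complex.exp (-(r * t))) (Ioi 0) := fun r =>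
    hpow.mul (by fun_prop)
  have hint : ∀ s : ℝ, 0 < s → ∀ b : ℝ, 0 < b →
      IntegrableOn (fun t : ℝ => t ^ (s - 1) * Real.exp (-(b * t))) (Ioi 0) := by
    intro s hs b hb
    have := integrableOn_rpow_mul_exp_neg_mul_rpow (s := s - 1) (p := 1) (b := b) (by linarith)
      one_pos hb
    simpa using this
  have hnorm : ∀ r : ℂ, ∀ t : ℝ, 0 < t → ‖(t : ℂ) ^ (z - 1) * Complex.exp (-(r * t))‖ =
      t ^ (z.re - 1) * Real.exp (-(r.re * t)) := by
    intro r t ht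
    rw [norm_mul, Complex.norm_cpow_eq_rpow_re_of_pos ht, Complex.norm_exp]
    simp
  have hdiff : DifferentiableOn ℂ
      (fun r : ℂ => ∫ t : ℝ in Ioi 0, (t : ℂ) ^ (z - 1) * Complex.exp (-(r * t))) U := by
    intro r (hr : 0 < r.re)
    refine (hasDerivAt_integral_of_dominated_loc_of_deriv_le
      (s := {r' : ℂ | r.re / 2 < r'.re})
      (F' := fun r t => (t : ℂ) ^ (z - 1) * (Complex.exp (-(r * t)) * (-t)))
      (bound := fun t => t ^ (z.re + 1 - 1) * Real.exp (-((r.re / 2) * t)))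
      ?_ ?_ ?_ ?_ ?_ ?_ ?_).2.differentiableAt.differentiableWithinAt
    · exact (isOpen_lt continuous_const Complex.continuous_re).mem_nhds
        (show r.re / 2 < r.re by linarith)
    · exact .of_forall fun r' => (hcont r').aestronglyMeasurable measurableSet_Ioi
    · refine Integrable.mono' (hint z.re hz r.re hr)
        ((hcont r).aestronglyMeasurable measurableSet_Ioi) ?_
      filter_upwards [ae_restrict_mem measurableSet_Ioi] with t ht
      exact (hnorm r t ht).le
    · refine ContinuousOn.aestronglyMeasurable (hpow.mul ?_) measurableSet_Ioi
      fun_prop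
    · filter_upwards [ae_restrict_mem measurableSet_Ioi] with t (ht : 0 < t) r' hr'
      have h1 : (t : ℝ) ^ (z.re + 1 - 1) = t ^ (z.re - 1) * t := by
        rw [← Real.rpow_add_one ht.ne']; ring_nf
      rw [← mul_assoc, norm_mul, hnorm r' t ht, h1, norm_neg, Complex.norm_real,
        Real.norm_of_nonneg ht.le, mul_right_comm]
      have hr2 : r.re / 2 ≤ r'.re := le_of_lt hr'
      gcongr
    · exact hint _ (by linarith) _ (by linarith)
    · refine .of_forall fun t r' _ => HasDerivAt.const_mul _ ?_
      have : HasDerivAt (fun r' : ℂ => -(r' * t)) (-t : ℂ) r' := by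
        simpa using! ((hasDerivAt_id r').mul_const (t : ℂ)).neg
      exact this.cexp
  have hdiff' : DifferentiableOn ℂ (fun r : ℂ => (1 / r) ^ z * Complex.Gamma z) U := by
    intro r (hr : 0 < r.re)
    have hr0 : r ≠ 0 := by rintro rfl; simp at hr
    have hsl : 1 / r ∈ Complex.slitPlane := by
      left
      rw [one_div, Complex.inv_re]
      exact div_pos hr (Complex.normSq_pos.2 hr0)
    have : DifferentiableAt ℂ (fun r : ℂ => 1 / r) r := by
      simpa using differentiableAt_inv hr0
    exact ((this.cpow_const hsl).mul_const _).differentiableWithinAt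
  have hconv : IsPreconnected U := (convex_halfSpace_re_gt 0).isPreconnected
  refine (hdiff.analyticOnNhd hU).eqOn_of_preconnected_of_frequently_eq
    (hdiff'.analyticOnNhd hU) hconv (z₀ := 1) (by simp [U]) ?_ hr
  have htend : Filter.Tendsto (fun n : ℕ => (((1 + 1 / ((n : ℝ) + 1) : ℝ)) : ℂ)) Filter.atTop
      (nhdsWithin 1 {1}ᶜ) := by
    refine tendsto_nhdsWithin_iff.2 ⟨?_, .of_forall fun n => ?_⟩
    · have := (tendsto_one_div_add_atTop_nhds_zero_nat (𝕜 := ℝ)).const_add 1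
      simpa [Function.comp_def] using (Complex.continuous_ofReal.tendsto _).comp this
    · have : (1 / ((n : ℝ) + 1)) ≠ 0 := by positivity
      simp only [mem_compl_iff, mem_singleton_iff]
      norm_cast
      simpa using this
  refine htend.frequently (Filter.Frequently.of_forall fun n => ?_)
  exact Complex.integral_cpow_mul_exp_neg_mul_Ioi hz (by positivity)

/-- Rotating the contour of the Gamma integral gives exponential decay at any rate `< π / 2`. -/

theorem norm_Gamma_mul_exp_le {z : ℂ} (hz : 0 < z.re) {θ : ℝ} (hθ : |θ| < π / 2) :
    ‖Complex.Gamma z‖ * Real.exp (θ * z.im) ≤ (1 / Real.cos θ) ^ z.re * Real.Gamma z.re := by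
  have hc : 0 < Real.cos θ := Real.cos_pos_of_mem_Ioo (abs_lt.1 hθ)
  have hre : 0 < (Complex.exp (θ * Complex.I)).re := by
    rw [Complex.exp_ofReal_mul_I_re]; exact hc
  have h1 := integral_cpow_mul_exp_neg_complex_mul_Ioi hz hre
  have h2 := Real.integral_rpow_mul_exp_neg_mul_Ioi hz hc
  have h3 : ‖(1 / Complex.exp (θ * Complex.I)) ^ z‖ = Real.exp (θ * z.im) := by
    have : 1 / Complex.exp (θ * Complex.I) = Complex.exp (((-θ : ℝ) : ℂ) * Complex.I) := by
      rw [one_div, ← Complex.exp_neg]; push_cast; ring_nf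
    rw [this, Complex.norm_cpow_of_ne_zero (Complex.exp_ne_zero _), Complex.norm_exp_ofReal_mul_I,
      Complex.arg_exp_mul_I, (toIocMod_eq_self _).2, Real.one_rpow, one_div, ← Real.exp_neg]
    · ring_nf
    · have := abs_lt.1 hθ
      constructor <;> linarith [Real.pi_pos]
  rw [mul_comm, ← h3, ← norm_mul, ← h1, ← h2]
  refine (norm_integral_le_integral_norm _).trans_eq (setIntegral_congr_fun measurableSet_Ioi ?_)
  intro t (ht : 0 < t)
  simp only [norm_mul, Complex.norm_cpow_eq_rpow_re_of_pos ht, Complex.norm_exp]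
  simp [Complex.exp_ofReal_mul_I_re]

theorem norm_Gamma_le_exp {p q : ℝ} (hp : 0 < p) {θ : ℝ} (hθ0 : 0 ≤ θ) (hθ : θ < π / 2) :
    ∃ C, ∀ z : ℂ, p ≤ z.re → z.re ≤ q → ‖Complex.Gamma z‖ ≤ C * Real.exp (-θ * |z.im|) := by
  have hc : 0 < Real.cos θ := Real.cos_pos_of_mem_Ioo ⟨by linarith [Real.pi_pos], hθ⟩
  have hcont : ContinuousOn (fun x : ℝ => (1 / Real.cos θ) ^ x * Real.Gamma x) (Icc p q) := by
    intro x hx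
    have hx0 : 0 < x := hp.trans_le hx.1
    refine (ContinuousAt.mul ?_ ?_).continuousWithinAt
    · exact (Real.continuous_const_rpow (by positivity)).continuousAt
    · refine (Real.differentiableAt_Gamma fun m => ?_).continuousAt
      have : (0:ℝ) ≤ m := m.cast_nonneg
      linarith
  obtain ⟨C, hC⟩ := isCompact_Icc.exists_bound_of_continuousOn hcont
  refine ⟨C, fun z hz1 hz2 => ?_⟩
  have key : ∀ η, |η| = θ → η * z.im = θ * |z.im| →
      ‖Complex.Gamma z‖ ≤ C * Real.exp (-θ * |z.im|) := by
    intro η h1 h2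
    have h := norm_Gamma_mul_exp_le (hp.trans_le hz1) (h1.trans_lt hθ)
    have h' := (le_norm_self _).trans (hC _ ⟨hz1, hz2⟩)
    have h3 : Real.cos η = Real.cos θ := by rw [← h1, Real.cos_abs]
    rw [h3, h2] at h
    rw [neg_mul, Real.exp_neg, ← div_eq_mul_inv, le_div_iff₀ (Real.exp_pos _)]
    exact h.trans h'
  rcases le_total 0 z.im with hy | hy
  · exact key θ (abs_of_nonneg hθ0) (by rw [abs_of_nonneg hy])
  · exact key (-θ) (by rw [abs_neg, abs_of_nonneg hθ0]) (by rw [abs_of_nonpos hy]; ring)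

theorem norm_sin_le_exp (z : ℂ) : ‖Complex.sin z‖ ≤ Real.exp |z.im| := by
  rw [Complex.sin]
  have h1 : ‖Complex.exp (-z * Complex.I)‖ ≤ Real.exp |z.im| := by
    rw [Complex.norm_exp]; simpa using le_abs_self _
  have h2 : ‖Complex.exp (z * Complex.I)‖ ≤ Real.exp |z.im| := by
    rw [Complex.norm_exp]; simpa using neg_le_abs _
  rw [norm_div, norm_mul, Complex.norm_I, mul_one, Complex.norm_two]
  linarith [norm_sub_le (Complex.exp (-z * Complex.I)) (Complex.exp (z * Complex.I))]

theorem inv_Gamma_eq_of_re_lt_one {z : ℂ} (hz : z.re < 1) :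
    (Complex.Gamma z)⁻¹ = Complex.Gamma (1 - z) * Complex.sin (π * z) / π := by
  have h := Complex.Gamma_mul_Gamma_one_sub z
  have h1 : Complex.Gamma (1 - z) ≠ 0 := Complex.Gamma_ne_zero_of_re_pos (by simpa using hz)
  have hpi : (π : ℂ) ≠ 0 := by exact_mod_cast Real.pi_ne_zero
  rw [← eq_div_iff h1] at h
  rw [h, inv_div, div_div_eq_mul_div]

theorem norm_inv_Gamma_le_exp_of_lt_one {p q : ℝ} (hq : q < 1) {θ : ℝ} (hθ0 : 0 ≤ θ)
    (hθ : θ < π / 2) :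
    ∃ C, ∀ z : ℂ, p ≤ z.re → z.re ≤ q →
      ‖(Complex.Gamma z)⁻¹‖ ≤ C * Real.exp ((π - θ) * |z.im|) := by
  obtain ⟨C, hC⟩ := norm_Gamma_le_exp (p := 1 - q) (q := 1 - p) (by linarith) hθ0 hθ
  refine ⟨C / π, fun z h1 h2 => ?_⟩
  have hG := hC (1 - z) (by simp; linarith) (by simp; linarith)
  have hs := norm_sin_le_exp (π * z)
  rw [inv_Gamma_eq_of_re_lt_one (h2.trans_lt hq), norm_div, norm_mul, Complex.norm_real,
    Real.norm_of_nonneg Real.pi_pos.le, div_mul_eq_mul_div]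
  refine div_le_div_of_nonneg_right ?_ Real.pi_pos.le
  have e1 : |(1 - z).im| = |z.im| := by simp
  have e2 : |(π * z : ℂ).im| = π * |z.im| := by
    simp [abs_mul, abs_of_pos Real.pi_pos]
  rw [e1] at hG
  rw [e2] at hs
  calc _ ≤ (C * Real.exp (-θ * |z.im|)) * Real.exp (π * |z.im|) :=
        mul_le_mul hG hs (norm_nonneg _) ((norm_nonneg _).trans hG)
    _ = _ := by rw [mul_assoc, ← Real.exp_add]; ring_nf

theorem norm_inv_Gamma_le_exp (p q : ℝ) {θ : ℝ} (hθ0 : 0 ≤ θ) (hθ : θ < π / 2) :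
    ∃ C, ∀ z : ℂ, p ≤ z.re → z.re ≤ q →
      ‖(Complex.Gamma z)⁻¹‖ ≤ C * Real.exp ((π - θ) * |z.im|) := by
  obtain ⟨n, hn⟩ := exists_nat_gt q
  induction n generalizing p q with
  | zero => exact norm_inv_Gamma_le_exp_of_lt_one (by simp at hn; linarith) hθ0 hθ
  | succ n ih =>
    obtain ⟨C, hC⟩ := ih (p - 1) (q - 1) (by push_cast at hn; linarith)
    obtain ⟨C', hC'⟩ := (isCompact_Icc.reProdIm (isCompact_Icc (a := (-1:ℝ)) (b := 1))
      |>.exists_bound_of_continuousOn (s := Icc p q ×ℂ Icc (-1) 1)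
      Complex.differentiable_one_div_Gamma.continuous.continuousOn)
    refine ⟨max C C', fun z h1 h2 => ?_⟩
    have hθπ : 0 ≤ π - θ := by linarith [Real.pi_pos]
    rcases le_total |z.im| 1 with hy | hy
    · have h := hC' z ⟨⟨h1, h2⟩, abs_le.1 hy⟩
      have h0 : 0 ≤ C' := (norm_nonneg _).trans h
      have h1 : 1 ≤ Real.exp ((π - θ) * |z.im|) := Real.one_le_exp (by positivity)
      calc _ ≤ C' * 1 := by simpa using h
        _ ≤ _ := by gcongr; exact le_max_right _ _
    · have h := hC (z - 1) (by simpa using h1) (by simpa using h2)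
      have hz : 1 ≤ ‖z - 1‖ := hy.trans (by simpa using Complex.abs_im_le_norm (z - 1))
      rw [Complex.one_div_Gamma_eq_self_mul_one_div_Gamma_add_one, sub_add_cancel, norm_mul] at h
      have e1 : |(z - 1).im| = |z.im| := by simp
      rw [e1] at h
      calc _ ≤ ‖z - 1‖ * ‖(Complex.Gamma z)⁻¹‖ := le_mul_of_one_le_left (norm_nonneg _) hz
        _ ≤ _ := h
        _ ≤ _ := by gcongr; exact le_max_left _ _

theorem integrable_exp_neg_mul_abs {δ : ℝ} (hδ : 0 < δ) :
    Integrable fun s : ℝ => Real.exp (-δ * |s|) := by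
  rw [← integrableOn_univ, ← Iic_union_Ioi (a := (0 : ℝ)), integrableOn_union]
  constructor
  · refine (integrableOn_exp_mul_Iic hδ 0).congr_fun (fun s (hs : s ≤ 0) => ?_) measurableSet_Iic
    simp only [abs_of_nonpos hs]; ring_nf
  · refine (integrableOn_exp_mul_Ioi (neg_lt_zero.2 hδ) 0).congr_fun
      (fun s (hs : 0 < s) => ?_) measurableSet_Ioi
    simp only [abs_of_pos hs]

/-- A function holomorphic on the half-plane `Re σ < b` which decays exponentially along vertical
lines, uniformly on closed vertical strips. -/
structure IsMellinBarnesKernel (F : ℂ → ℂ) (b : ℝ) : Prop where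
  differentiableAt : ∀ σ : ℂ, σ.re < b → DifferentiableAt ℂ F σ
  decay : ∀ p q : ℝ, q < b → ∃ C δ : ℝ, 0 < δ ∧
    ∀ σ : ℂ, p ≤ σ.re → σ.re ≤ q → ‖F σ‖ ≤ C * Real.exp (-δ * |σ.im|)

/-- The integral of `F σ * w ^ σ` along the vertical line `Re σ = γ`. -/
def mellinBarnes (F : ℂ → ℂ) (γ w : ℝ) : ℂ :=
  ∫ s : ℝ, F (γ + s * Complex.I) * (w : ℂ) ^ ((γ : ℂ) + s * Complex.I)

theorem norm_ofReal_cpow_line {w : ℝ} (hw : 0 < w) (γ s : ℝ) :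
    ‖(w : ℂ) ^ ((γ : ℂ) + s * Complex.I)‖ = w ^ γ := by
  rw [Complex.norm_cpow_eq_rpow_re_of_pos hw]; simp

namespace IsMellinBarnesKernel

variable {F G : ℂ → ℂ} {b : ℝ}

theorem id_mul (hF : IsMellinBarnesKernel F b) :
    IsMellinBarnesKernel (fun σ => σ * F σ) b where
  differentiableAt σ hσ := differentiableAt_id.mul (hF.differentiableAt σ hσ)
  decay p q hq := by
    obtain ⟨C, δ, hδ, h⟩ := hF.decay p q hq
    set A := max |p| |q|
    refine ⟨(A + 2 / δ) * C, δ / 2, by positivity, fun σ h1 h2 => ?_⟩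
    have hσ : ‖σ‖ ≤ A + |σ.im| :=
      (Complex.norm_le_abs_re_add_abs_im σ).trans (by gcongr; exact abs_le_max_abs_abs h1 h2)
    have hA : 0 ≤ A := (abs_nonneg p).trans (le_max_left _ _)
    have hF' := h σ h1 h2
    have hC : 0 ≤ C := nonneg_of_mul_nonneg_left ((norm_nonneg _).trans hF') (Real.exp_pos _)
    have hexp : 1 ≤ Real.exp (δ / 2 * |σ.im|) := Real.one_le_exp (by positivity)
    have hlin : |σ.im| ≤ 2 / δ * Real.exp (δ / 2 * |σ.im|) := by
      have := Real.add_one_le_exp (δ / 2 * |σ.im|)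
      rw [div_mul_eq_mul_div, le_div_iff₀ hδ]
      nlinarith
    have hpoly : ‖σ‖ ≤ (A + 2 / δ) * Real.exp (δ / 2 * |σ.im|) := by
      nlinarith
    calc ‖σ * F σ‖ ≤ ((A + 2 / δ) * Real.exp (δ / 2 * |σ.im|)) *
          (C * Real.exp (-δ * |σ.im|)) := by
          rw [norm_mul]; gcongr
      _ = (A + 2 / δ) * C * (Real.exp (δ / 2 * |σ.im|) * Real.exp (-δ * |σ.im|)) := by ring
      _ = _ := by rw [← Real.exp_add]; ring_nf

theorem continuous_line (hF : IsMellinBarnesKernel F b) {γ : ℝ} (hγ : γ < b) :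
    Continuous fun s : ℝ => F (γ + s * Complex.I) :=
  continuous_iff_continuousAt.2 fun s =>
    ContinuousAt.comp (f := fun s : ℝ => (γ : ℂ) + s * Complex.I)
      (hF.differentiableAt _ (by simpa using hγ)).continuousAt (by fun_prop)

theorem integrable_line (hF : IsMellinBarnesKernel F b) {γ : ℝ} (hγ : γ < b) :
    Integrable fun s : ℝ => F (γ + s * Complex.I) := by
  obtain ⟨C, δ, hδ, H⟩ := hF.decay γ γ hγ
  refine ((integrable_exp_neg_mul_abs hδ).const_mul C).mono'
    (hF.continuous_line hγ).aestronglyMeasurable (.of_forall fun s => ?_)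
  simpa using H (γ + s * Complex.I) (by simp) (by simp)

theorem continuous_cpow_line {w : ℝ} (hw : 0 < w) (γ : ℝ) :
    Continuous fun s : ℝ => (w : ℂ) ^ ((γ : ℂ) + s * Complex.I) :=
  Continuous.const_cpow (by fun_prop) (Or.inl (by exact_mod_cast hw.ne'))

theorem integrable (hF : IsMellinBarnesKernel F b) {γ w : ℝ} (hγ : γ < b) (hw : 0 < w) :
    Integrable fun s : ℝ => F (γ + s * Complex.I) * (w : ℂ) ^ ((γ : ℂ) + s * Complex.I) :=
  (hF.integrable_line hγ).mul_bdd (c := w ^ γ)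
    (continuous_cpow_line hw γ).aestronglyMeasurable
    (.of_forall fun s => (norm_ofReal_cpow_line hw γ s).le)

theorem mellinBarnes_linear (hF : IsMellinBarnesKernel F b) (hG : IsMellinBarnesKernel G b)
    {γ w : ℝ} (hγ : γ < b) (hw : 0 < w) (k m : ℂ) :
    mellinBarnes (fun σ => k * F σ + m * G σ) γ w =
      k * mellinBarnes F γ w + m * mellinBarnes G γ w := by
  simp only [mellinBarnes]
  rw [← integral_const_mul, ← integral_const_mul,
    ← integral_add ((hF.integrable hγ hw).const_mul k) ((hG.integrable hγ hw).const_mul m)]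
  congr 1 with s
  ring

/-- Cauchy's theorem: the integral does not depend on the vertical line. -/

theorem mellinBarnes_eq (hF : IsMellinBarnesKernel F b) {γ γ' w : ℝ} (hγ : γ < b) (hγ' : γ' < b)
    (hw : 0 < w) : mellinBarnes F γ w = mellinBarnes F γ' w := by
  set H : ℂ → ℂ := fun σ => F σ * (w : ℂ) ^ σ with hH
  obtain ⟨C, δ, hδ, hdec⟩ := hF.decay (min γ γ') (max γ γ') (max_lt hγ hγ')
  obtain ⟨B, hB⟩ := (isCompact_uIcc (a := γ) (b := γ')).exists_bound_of_continuousOn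
    (Real.continuous_const_rpow hw.ne').continuousOn
  have hC : 0 ≤ C := nonneg_of_mul_nonneg_left ((norm_nonneg _).trans
    (hdec (γ : ℂ) (by simp) (by simp))) (Real.exp_pos _)
  have hbound : ∀ x ∈ uIcc γ γ', ∀ y : ℝ, ‖H (x + y * Complex.I)‖ ≤
      C * Real.exp (-δ * |y|) * B := by
    intro x hx y
    have h1 := hdec (x + y * Complex.I) (by simpa using hx.1) (by simpa using hx.2)
    have h2 := (le_norm_self _).trans (hB x hx)
    rw [hH, norm_mul, norm_ofReal_cpow_line hw]
    have e : (x + y * Complex.I : ℂ).im = y := by simp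
    rw [e] at h1
    gcongr
  have hhor : ∀ ε : ℝ, |ε| = 1 → Filter.Tendsto
      (fun T : ℝ => ∫ x : ℝ in γ..γ', H (x + (ε * T : ℝ) * Complex.I))
      Filter.atTop (nhds 0) := by
    intro ε hε
    have hlim : Filter.Tendsto (fun T : ℝ => C * Real.exp (-δ * T) * B * |γ' - γ|)
        Filter.atTop (nhds 0) := by
      have h1 : Filter.Tendsto (fun T : ℝ => Real.exp (-δ * T)) Filter.atTop (nhds 0) :=
        Real.tendsto_exp_atBot.comp
          (Filter.tendsto_id.const_mul_atTop_of_neg (neg_lt_zero.2 hδ))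
      simpa using ((h1.const_mul C).mul_const B).mul_const |γ' - γ|
    refine squeeze_zero_norm' ?_ hlim
    filter_upwards [Filter.eventually_ge_atTop 0] with T hT
    refine intervalIntegral.norm_integral_le_of_norm_le_const fun x hx => ?_
    have := hbound x (uIoc_subset_uIcc hx) (ε * T)
    rwa [abs_mul, hε, one_mul, abs_of_nonneg hT] at this
  have hver : ∀ η : ℝ, η < b → Filter.Tendsto
      (fun T : ℝ => ∫ y : ℝ in (-T)..T, H (η + y * Complex.I)) Filter.atTop
      (nhds (mellinBarnes F η w)) := fun η hη =>
    intervalIntegral_tendsto_integral (hF.integrable hη hw) Filter.tendsto_neg_atTop_atBot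
      Filter.tendsto_id
  have hrect : ∀ T : ℝ, (∫ x : ℝ in γ..γ', H (x + ((-1) * T : ℝ) * Complex.I)) -
      (∫ x : ℝ in γ..γ', H (x + (1 * T : ℝ) * Complex.I)) +
      Complex.I * (∫ y : ℝ in (-T)..T, H (γ' + y * Complex.I)) -
      Complex.I * (∫ y : ℝ in (-T)..T, H (γ + y * Complex.I)) = 0 := by
    intro T
    have := Complex.integral_boundary_rect_eq_zero_of_differentiableOn H
      (γ + ((-T : ℝ) : ℂ) * Complex.I) (γ' + (T : ℂ) * Complex.I) (by
        intro σ hσ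
        have hσ1 : σ.re ∈ uIcc γ γ' := by simpa using hσ.1
        have : σ.re < b := hσ1.2.trans_lt (max_lt hγ hγ')
        refine ((hF.differentiableAt σ this).mul ?_).differentiableWithinAt
        exact differentiableAt_id.const_cpow (Or.inl (by exact_mod_cast hw.ne')))
    simpa using this
  have hlim := (((hhor (-1) (by simp)).sub (hhor 1 (by simp))).add
    ((hver γ' hγ').const_mul Complex.I)).sub ((hver γ hγ).const_mul Complex.I)
  simp only [hrect] at hlim
  have := tendsto_nhds_unique hlim tendsto_const_nhds
  rw [sub_zero, zero_add, sub_eq_zero] at this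
  exact (mul_left_cancel₀ Complex.I_ne_zero this).symm

theorem hasDerivAt_mellinBarnes (hF : IsMellinBarnesKernel F b) {γ w : ℝ} (hγ : γ < b)
    (hw : 0 < w) :
    HasDerivAt (mellinBarnes F γ) ((w : ℂ)⁻¹ * mellinBarnes (fun σ => σ * F σ) γ w) w := by
  have hs : Icc (w / 2) (2 * w) ∈ nhds w := Icc_mem_nhds (by linarith) (by linarith)
  obtain ⟨B, hB⟩ := (isCompact_Icc (a := w / 2) (b := 2 * w)).exists_bound_of_continuousOn
    (f := fun x : ℝ => x ^ (γ - 1)) (fun x hx =>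
      (Real.continuousAt_rpow_const x _ (
        Or.inl (show 0 < x by linarith [hx.1]).ne')).continuousWithinAt)
  have hpos : ∀ x ∈ Icc (w / 2) (2 * w), 0 < x := fun x hx => by linarith [hx.1]
  have hline : ∀ s : ℝ, (γ : ℂ) + s * Complex.I - 1 = ((γ - 1 : ℝ) : ℂ) + s * Complex.I := by
    intro s; push_cast; ring
  have key := (hasDerivAt_integral_of_dominated_loc_of_deriv_le (μ := volume)
    (F := fun (x : ℝ) (s : ℝ) => F (γ + s * Complex.I) * (x : ℂ) ^ ((γ : ℂ) + s * Complex.I))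
    (F' := fun (x : ℝ) (s : ℝ) => F (γ + s * Complex.I) *
      (((γ : ℂ) + s * Complex.I) * (x : ℂ) ^ ((γ : ℂ) + s * Complex.I - 1)))
    (bound := fun s : ℝ => ‖(γ + s * Complex.I) * F (γ + s * Complex.I)‖ * B)
    hs ?_ (hF.integrable hγ hw) ?_ ?_ ((hF.id_mul.integrable_line hγ).norm.mul_const B) ?_).2
  · convert! key using 1
    rw [mellinBarnes, ← integral_const_mul]
    congr 1 with s
    rw [Complex.cpow_sub _ _ (by exact_mod_cast hw.ne'), Complex.cpow_one]
    ring
  · filter_upwards [hs] with x hx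
    exact (hF.integrable hγ (hpos x hx)).aestronglyMeasurable
  · refine ((hF.continuous_line hγ).mul (Continuous.mul (by fun_prop) ?_)).aestronglyMeasurable
    simp only [hline]
    exact continuous_cpow_line hw _
  · refine .of_forall fun s x hx => ?_
    rw [← mul_assoc, mul_comm (F _), norm_mul, hline, norm_ofReal_cpow_line (hpos x hx)]
    gcongr
    exact (le_norm_self _).trans (hB x hx)
  · refine .of_forall fun s x hx => HasDerivAt.const_mul _ ?_
    have hsl : (x : ℂ) ∈ Complex.slitPlane := Or.inl (by simpa using hpos x hx)
    simpa using ((hasDerivAt_id (x : ℂ)).cpow_const (c := (γ : ℂ) + s * Complex.I) hsl).comp_ofReal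

end IsMellinBarnesKernel

theorem mellinBarnes_comp_add_real (F : ℂ → ℂ) (γ h : ℝ) {w : ℝ} (hw : 0 < w) :
    mellinBarnes (fun σ => F (σ + h)) γ w = (w : ℂ) ^ (-h : ℂ) * mellinBarnes F (γ + h) w := by
  rw [mellinBarnes, mellinBarnes, ← integral_const_mul]
  congr 1 with s
  have e : ((γ + h : ℝ) : ℂ) + s * Complex.I = γ + s * Complex.I + h := by push_cast; ring
  have hw0 : (w : ℂ) ≠ 0 := by exact_mod_cast hw.ne'
  rw [e, mul_left_comm, ← Complex.cpow_add _ _ hw0]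
  ring_nf

/-- The Mellin–Barnes kernel `Γ(b₁ - σ) Γ(b₂ - σ) / Γ(μ - 2 α σ)`. -/
def foxKernel (α μ b₁ b₂ : ℝ) (σ : ℂ) : ℂ :=
  Complex.Gamma (b₁ - σ) * Complex.Gamma (b₂ - σ) * (Complex.Gamma (μ - 2 * α * σ))⁻¹

theorem foxKernel_comm (α μ b₁ b₂ : ℝ) : foxKernel α μ b₁ b₂ = foxKernel α μ b₂ b₁ := by
  ext σ
  simp only [foxKernel]
  ring

theorem foxKernel_add_half (α μ b₁ b₂ : ℝ) :
    (fun σ => foxKernel α μ b₁ b₂ (σ + ((1 / 2 : ℝ) : ℂ))) =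
      foxKernel α (μ - α) (b₁ - 1 / 2) (b₂ - 1 / 2) := by
  ext σ
  simp only [foxKernel]
  push_cast
  ring_nf

theorem foxKernel_add_one_left (α μ b₁ b₂ : ℝ) {σ : ℂ} (hσ : σ.re < b₁) :
    foxKernel α μ (b₁ + 1) b₂ σ = (b₁ - σ) * foxKernel α μ b₁ b₂ σ := by
  have h : (b₁ : ℂ) - σ ≠ 0 := fun h => by
    have := congrArg Complex.re h
    simp at this
    linarith
  have e : ((b₁ + 1 : ℝ) : ℂ) - σ = (b₁ - σ) + 1 := by push_cast; ring
  simp only [foxKernel]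
  rw [e, Complex.Gamma_add_one _ h]
  ring

theorem foxKernel_eq_mul_foxKernel_add_one (α μ b₁ b₂ : ℝ) (σ : ℂ) :
    foxKernel α μ b₁ b₂ σ = (μ - 2 * α * σ) * foxKernel α (μ + 1) b₁ b₂ σ := by
  have e : ((μ + 1 : ℝ) : ℂ) - 2 * α * σ = (μ - 2 * α * σ) + 1 := by push_cast; ring
  simp only [foxKernel]
  rw [e, Complex.one_div_Gamma_eq_self_mul_one_div_Gamma_add_one]
  ring

theorem isMellinBarnesKernel_foxKernel {α : ℝ} (hα0 : 0 < α) (hα1 : α < 1) (μ b₁ b₂ : ℝ) :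
    IsMellinBarnesKernel (foxKernel α μ b₁ b₂) (min b₁ b₂) where
  differentiableAt σ hσ := by
    have hΓ : ∀ b : ℝ, σ.re < b → DifferentiableAt ℂ (fun σ => Complex.Gamma (b - σ)) σ := by
      intro b hb
      have : DifferentiableAt ℂ Complex.Gamma (b - σ) := by
        refine Complex.differentiableAt_Gamma _ fun m hm => ?_
        have := congrArg Complex.re hm
        simp at this
        have hm0 : (0 : ℝ) ≤ m := m.cast_nonneg
        linarith
      exact this.comp σ (differentiableAt_id.const_sub _)
    refine ((hΓ b₁ (hσ.trans_le (min_le_left _ _))).mul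
      (hΓ b₂ (hσ.trans_le (min_le_right _ _)))).mul ?_
    exact (Complex.differentiable_one_div_Gamma (μ - 2 * α * σ)).comp σ
      (f := fun σ : ℂ => (μ - 2 * α * σ : ℂ)) (by fun_prop)
  decay p q hq := by
    have hpi := Real.pi_pos
    set θ : ℝ := π * (1 + α) / 4 with hθdef
    have hθ0 : 0 ≤ θ := by positivity
    have hθ : θ < π / 2 := by rw [hθdef]; nlinarith
    have hq1 : q < b₁ := hq.trans_le (min_le_left _ _)
    have hq2 : q < b₂ := hq.trans_le (min_le_right _ _)
    obtain ⟨C₁, h₁⟩ := norm_Gamma_le_exp (p := b₁ - q) (q := b₁ - p) (by linarith) hθ0 hθ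
    obtain ⟨C₂, h₂⟩ := norm_Gamma_le_exp (p := b₂ - q) (q := b₂ - p) (by linarith) hθ0 hθ
    obtain ⟨C₃, h₃⟩ := norm_inv_Gamma_le_exp (μ - 2 * α * q) (μ - 2 * α * p) hθ0 hθ
    refine ⟨C₁ * C₂ * C₃, π * (1 - α) ^ 2 / 2, by have := sub_pos.2 hα1; positivity,
      fun σ hp' hq' => ?_⟩
    have g₁ := h₁ (b₁ - σ) (by simp; linarith) (by simp; linarith)
    have g₂ := h₂ (b₂ - σ) (by simp; linarith) (by simp; linarith)
    have g₃ := h₃ (μ - 2 * α * σ) (by simp; nlinarith) (by simp; nlinarith)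
    have e₁ : |(b₁ - σ : ℂ).im| = |σ.im| := by simp
    have e₂ : |(b₂ - σ : ℂ).im| = |σ.im| := by simp
    have e₃ : |(μ - 2 * α * σ : ℂ).im| = 2 * α * |σ.im| := by
      simp [abs_mul, abs_of_pos hα0]
    rw [e₁] at g₁
    rw [e₂] at g₂
    rw [e₃] at g₃
    have n₁ := (norm_nonneg _).trans g₁
    have n₂ := (norm_nonneg _).trans g₂
    calc ‖foxKernel α μ b₁ b₂ σ‖ ≤ (C₁ * Real.exp (-θ * |σ.im|)) * (C₂ * Real.exp (-θ * |σ.im|)) *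
          (C₃ * Real.exp ((π - θ) * (2 * α * |σ.im|))) := by
          rw [foxKernel, norm_mul, norm_mul]
          gcongr
      _ = C₁ * C₂ * C₃ * (Real.exp (-θ * |σ.im|) * Real.exp (-θ * |σ.im|) *
          Real.exp ((π - θ) * (2 * α * |σ.im|))) := by ring
      _ = _ := by
          rw [← Real.exp_add, ← Real.exp_add, hθdef]
          ring_nf

theorem foxH2012_eq (α b₁ b₂ γ w : ℝ) :
    foxH2012 α b₁ b₂ γ w =
      1 / (2 * π) * (mellinBarnes (foxKernel α 1 b₁ b₂) γ w).re := by
  simp only [foxH2012, mellinBarnes, foxKernel, div_eq_mul_inv, Complex.ofReal_one]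

/-- The kernel relation `(p - σ) Γ(p - σ) = Γ(p + 1 - σ)` followed by the shift `σ ↦ σ + 1 / 2`. -/

theorem mellinBarnes_foxKernel_contiguous {α : ℝ} (hα0 : 0 < α) (hα1 : α < 1)
    {p q γ γ₀ w : ℝ} (hγ : γ < min p q)
    (hγ₀ : γ₀ < min (p + 1 / 2) (q - 1 / 2)) (hw : 0 < w) :
    p * mellinBarnes (foxKernel α 1 p q) γ w -
        mellinBarnes (fun σ => σ * foxKernel α 1 p q σ) γ w =
      (w : ℂ) ^ (1 / 2 : ℂ) * mellinBarnes (foxKernel α (1 - α) (p + 1 / 2) (q - 1 / 2)) γ₀ w := by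
  have hK := isMellinBarnesKernel_foxKernel hα0 hα1 1 p q
  have hK' := isMellinBarnesKernel_foxKernel hα0 hα1 1 (p + 1) q
  have hγp : γ < p := hγ.trans_le (min_le_left _ _)
  have hγ' : γ < min (p + 1) q :=
    lt_min (by linarith) (hγ.trans_le (min_le_right _ _))
  have hγ₀' : γ₀ + 1 / 2 < min (p + 1) q :=
    lt_min (by linarith [hγ₀.trans_le (min_le_left _ _)])
      (by linarith [hγ₀.trans_le (min_le_right _ _)])
  have h1 : (p : ℂ) * mellinBarnes (foxKernel α 1 p q) γ w -
      mellinBarnes (fun σ => σ * foxKernel α 1 p q σ) γ w =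
      mellinBarnes (foxKernel α 1 (p + 1) q) γ w := by
    have := hK.mellinBarnes_linear hK.id_mul hγ hw p (-1)
    rw [neg_one_mul, ← sub_eq_add_neg] at this
    rw [← this]
    simp only [mellinBarnes]
    congr 1 with s
    rw [foxKernel_add_one_left α 1 p q (by simpa using hγp)]
    ring
  have h2 := mellinBarnes_comp_add_real (foxKernel α 1 (p + 1) q) γ₀ (1 / 2) hw
  rw [foxKernel_add_half, ← hK'.mellinBarnes_eq hγ' hγ₀' hw, ← h1,
    show p + 1 - 1 / 2 = p + 1 / 2 by ring] at h2
  rw [h2, ← mul_assoc, ← Complex.cpow_add _ _ (by exact_mod_cast hw.ne')]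
  push_cast
  norm_num

theorem hasDerivAt_rpow_mul_mellinBarnes_foxKernel {α : ℝ} (hα0 : 0 < α) (hα1 : α < 1)
    {p q γ γ₀ τ y : ℝ} (hγ : γ < min p q)
    (hγ₀ : γ₀ < min (p + 1 / 2) (q - 1 / 2)) (hτ : 0 < τ) (hy : 0 < y) :
    HasDerivAt
      (fun y : ℝ => y ^ (-2 * p) * (mellinBarnes (foxKernel α 1 p q) γ (y ^ 2 * τ ^ 2 / 4)).re)
      (-τ * y ^ (-2 * p) * (mellinBarnes (foxKernel α (1 - α) (p + 1 / 2) (q - 1 / 2)) γ₀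
        (y ^ 2 * τ ^ 2 / 4)).re) y := by
  set w := y ^ 2 * τ ^ 2 / 4 with hwdef
  have hw : 0 < w := by positivity
  have hK := isMellinBarnesKernel_foxKernel hα0 hα1 1 p q
  have hcont := congrArg Complex.re (mellinBarnes_foxKernel_contiguous hα0 hα1 hγ hγ₀ hw)
  have hhalf : (w : ℂ) ^ (1 / 2 : ℂ) = ((y * τ / 2 : ℝ) : ℂ) := by
    have : w ^ (1 / 2 : ℝ) = y * τ / 2 := by
      rw [← Real.sqrt_eq_rpow, show w = (y * τ / 2) ^ 2 by rw [hwdef]; ring,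
        Real.sqrt_sq (by positivity)]
    rw [← this, Complex.ofReal_cpow hw.le]
    push_cast
    rfl
  rw [hhalf, Complex.sub_re, Complex.re_ofReal_mul, Complex.re_ofReal_mul] at hcont
  have hM : HasDerivAt (fun w => (mellinBarnes (foxKernel α 1 p q) γ w).re)
      (w⁻¹ * (mellinBarnes (fun σ => σ * foxKernel α 1 p q σ) γ w).re) w := by
    have := Complex.reCLM.hasFDerivAt.comp_hasDerivAt w (hK.hasDerivAt_mellinBarnes hγ hw)
    rw [← Complex.ofReal_inv] at this
    simpa only [Complex.reCLM_apply, Complex.re_ofReal_mul] using! this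
  have hin : HasDerivAt (fun y : ℝ => y ^ 2 * τ ^ 2 / 4) (y * τ ^ 2 / 2) y := by
    have := (((hasDerivAt_pow 2 y).mul_const (τ ^ 2)).div_const 4)
    convert! this using 1
    norm_num
    ring
  have hpow : HasDerivAt (fun y : ℝ => y ^ (-2 * p)) (-2 * p * y ^ (-2 * p) / y) y := by
    have := Real.hasDerivAt_rpow_const (x := y) (p := -2 * p) (Or.inl hy.ne')
    rwa [Real.rpow_sub_one hy.ne', ← mul_div_assoc] at this
  convert! hpow.mul (hM.comp y hin) using 1
  simp only [Function.comp]
  rw [← hwdef]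
  set M := (mellinBarnes (foxKernel α 1 p q) γ w).re
  set N := (mellinBarnes (foxKernel α (1 - α) (p + 1 / 2) (q - 1 / 2)) γ₀ w).re
  set S := (mellinBarnes (fun σ => σ * foxKernel α 1 p q σ) γ w).re
  have hS : S = p * M - y * τ / 2 * N := by linarith
  rw [hS, hwdef]
  field_simp
  ring

theorem integral_cpow_mul_sub_cpow {α : ℝ} (hα1 : α < 1) {z : ℂ} (hz : 0 < z.re)
    {t : ℝ} (ht : 0 < t) :
    ∫ s : ℝ in (0 : ℝ)..t, (s : ℂ) ^ (z - 1) * (((t - s) ^ (-α) : ℝ) : ℂ) =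
      (t : ℂ) ^ (z - α) * (Complex.Gamma z * Complex.Gamma (1 - α) *
        (Complex.Gamma (z + (1 - α)))⁻¹) := by
  have hα : (0 : ℝ) < (1 - α : ℂ).re := by simpa using hα1
  have hzα : Complex.Gamma (z + (1 - α)) ≠ 0 :=
    Complex.Gamma_ne_zero_of_re_pos (by rw [Complex.add_re]; exact add_pos hz hα)
  have h := Complex.betaIntegral_scaled z (1 - α) ht
  rw [Complex.Gamma_mul_Gamma_eq_betaIntegral hz hα, mul_right_comm, mul_inv_cancel₀ hzα, one_mul,
    show z - α = z + (1 - α) - 1 by ring, ← h]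
  refine intervalIntegral.integral_congr_ae (.of_forall fun s hs => ?_)
  rw [uIoc_of_le ht.le] at hs
  rw [Complex.ofReal_cpow (sub_nonneg.2 hs.2)]
  push_cast
  ring_nf

theorem ofReal_mul_rpow_cpow {A s : ℝ} (hA : 0 < A) (hs : 0 < s) (m : ℝ) (σ : ℂ) :
    ((A * s ^ m : ℝ) : ℂ) ^ σ = (A : ℂ) ^ σ * (s : ℂ) ^ (m * σ) := by
  have hsm : ((s ^ m : ℝ) : ℂ) = (s : ℂ) ^ (m : ℂ) := Complex.ofReal_cpow hs.le m
  rw [Complex.ofReal_mul, Complex.mul_cpow_ofReal_nonneg hA.le (Real.rpow_nonneg hs.le m), hsm]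
  congr 1
  have hs0 : (s : ℂ) ≠ 0 := by exact_mod_cast hs.ne'
  have hsm0 : ((s ^ m : ℝ) : ℂ) ≠ 0 := by exact_mod_cast (Real.rpow_pos_of_pos hs m).ne'
  rw [← hsm, Complex.cpow_def_of_ne_zero hsm0, Complex.cpow_def_of_ne_zero hs0,
    ← Complex.ofReal_log (by positivity), Real.log_rpow hs, ← Complex.ofReal_log hs.le]
  push_cast
  ring_nf

theorem integrable_mellinBarnes_mul_sub_rpow {α : ℝ} (hα0 : 0 < α) (hα1 : α < 1)
    {F : ℂ → ℂ} {b γ A t : ℝ}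
    (hF : IsMellinBarnesKernel F b) (hγ : γ < b) (hγ0 : γ ≤ 0) (hA : 0 < A) (ht : 0 < t) :
    Integrable (fun x : ℝ × ℝ => F (γ + x.2 * Complex.I) *
      ((A * x.1 ^ (-(2 * α)) : ℝ) : ℂ) ^ ((γ : ℂ) + x.2 * Complex.I) *
        (((t - x.1) ^ (-α) : ℝ) : ℂ)) ((volume.restrict (uIoc 0 t)).prod volume) := by
  rw [uIoc_of_le ht.le]
  have hsub : IntegrableOn (fun s : ℝ => (t - s) ^ (-α)) (Ioc 0 t) := by
    rw [← intervalIntegrable_iff_integrableOn_Ioc_of_le ht.le]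
    have := (intervalIntegral.intervalIntegrable_rpow' (a := 0) (b := t) (r := -α)
      (by linarith)).comp_sub_left t
    simpa using this.symm
  have hbound := (hsub.const_mul ((A * t ^ (-(2 * α))) ^ γ)).mul_prod
    (hF.integrable_line hγ).norm
  refine hbound.mono' ?_ ?_
  · refine Measurable.aestronglyMeasurable ?_
    have h1 : Measurable fun x : ℝ × ℝ => F (γ + x.2 * Complex.I) :=
      (hF.continuous_line hγ).measurable.comp measurable_snd
    have h2 : Measurable fun x : ℝ × ℝ =>
        ((A * x.1 ^ (-(2 * α)) : ℝ) : ℂ) ^ ((γ : ℂ) + x.2 * Complex.I) := by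
      fun_prop
    have h3 : Measurable fun x : ℝ × ℝ => (((t - x.1) ^ (-α) : ℝ) : ℂ) := by fun_prop
    exact (h1.mul h2).mul h3
  · have hmem : ∀ᵐ x : ℝ × ℝ ∂((volume.restrict (Ioc 0 t)).prod volume), x.1 ∈ Ioc 0 t :=
      Measure.quasiMeasurePreserving_fst.ae (ae_restrict_mem measurableSet_Ioc)
    filter_upwards [hmem] with x hx
    have hw : 0 < A * x.1 ^ (-(2 * α)) := mul_pos hA (Real.rpow_pos_of_pos hx.1 _)
    have hwt : 0 < A * t ^ (-(2 * α)) := mul_pos hA (Real.rpow_pos_of_pos ht _)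
    have hle : (A * x.1 ^ (-(2 * α))) ^ γ ≤ (A * t ^ (-(2 * α))) ^ γ := by
      refine Real.rpow_le_rpow_of_nonpos hwt ?_ hγ0
      have := Real.rpow_le_rpow_of_nonpos hx.1 hx.2 (show -(2 * α) ≤ 0 by linarith)
      gcongr
    have hts : 0 ≤ (t - x.1) ^ (-α) := Real.rpow_nonneg (sub_nonneg.2 hx.2) _
    rw [norm_mul, norm_mul, norm_ofReal_cpow_line hw, Complex.norm_real, Real.norm_of_nonneg hts,
      mul_comm, mul_comm ‖F _‖, ← mul_assoc, mul_comm ((t - x.1) ^ (-α))]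
    gcongr

theorem integral_mellinBarnes_foxKernel_mul_sub_rpow {α : ℝ} (hα0 : 0 < α) (hα1 : α < 1)
    {b₁ b₂ γ A t : ℝ} (hγ : γ < min b₁ b₂)
    (hγ0 : γ ≤ 0) (hA : 0 < A) (ht : 0 < t) :
    ∫ s in (0 : ℝ)..t, mellinBarnes (foxKernel α 1 b₁ b₂) γ (A * s ^ (-(2 * α))) *
        (((t - s) ^ (-α) : ℝ) : ℂ) =
      Real.Gamma (1 - α) * ((t ^ (1 - α) : ℝ) : ℂ) *
        mellinBarnes (foxKernel α (2 - α) b₁ b₂) γ (A * t ^ (-(2 * α))) := by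
  have hK := isMellinBarnesKernel_foxKernel hα0 hα1 1 b₁ b₂
  simp only [mellinBarnes]
  simp_rw [← integral_mul_const]
  rw [intervalIntegral_integral_swap
    (integrable_mellinBarnes_mul_sub_rpow hα0 hα1 hK hγ hγ0 hA ht), ← integral_const_mul]
  congr 1 with y
  set σ : ℂ := γ + y * Complex.I with hσ
  have hre : 0 < (1 - 2 * α * σ).re := by simp [hσ]; nlinarith
  have hint : ∫ s in (0 : ℝ)..t, foxKernel α 1 b₁ b₂ σ * ((A * s ^ (-(2 * α)) : ℝ) : ℂ) ^ σ *
        (((t - s) ^ (-α) : ℝ) : ℂ) =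
      foxKernel α 1 b₁ b₂ σ * (A : ℂ) ^ σ * ∫ s in (0 : ℝ)..t,
        (s : ℂ) ^ ((1 - 2 * α * σ) - 1) * (((t - s) ^ (-α) : ℝ) : ℂ) := by
    rw [← intervalIntegral.integral_const_mul]
    refine intervalIntegral.integral_congr_ae (.of_forall fun s hs => ?_)
    rw [uIoc_of_le ht.le] at hs
    rw [ofReal_mul_rpow_cpow hA hs.1]
    push_cast
    ring_nf
  have ht0 : (t : ℂ) ≠ 0 := by exact_mod_cast ht.ne'
  rw [hint, integral_cpow_mul_sub_cpow hα1 hre ht, ofReal_mul_rpow_cpow hA ht,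
    Complex.ofReal_cpow ht.le, ← Complex.Gamma_ofReal,
    show (1 - 2 * α * σ - α : ℂ) = ((1 - α : ℝ) : ℂ) + ((-(2 * α) : ℝ) : ℂ) * σ by push_cast; ring,
    Complex.cpow_add _ _ ht0]
  have hΓ := Complex.Gamma_ne_zero_of_re_pos hre
  simp only [foxKernel]
  rw [show (1 - 2 * α * σ + (1 - α) : ℂ) = ((2 - α : ℝ) : ℂ) - 2 * α * σ by push_cast; ring,
    Complex.ofReal_one]
  generalize Complex.Gamma (1 - 2 * α * σ) = G at hΓ ⊢
  generalize Complex.Gamma (((2 - α : ℝ) : ℂ) - 2 * α * σ) = G'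
  rw [show ((1 - α : ℝ) : ℂ) = 1 - α by push_cast; rfl]
  field_simp

theorem rlKernel_mellinBarnes_foxKernel {α : ℝ} (hα0 : 0 < α) (hα1 : α < 1)
    {b₁ b₂ γ A t : ℝ} (hγ : γ < min b₁ b₂)
    (hγ0 : γ ≤ 0) (hA : 0 < A) (ht : 0 < t) (k : ℝ) {h : ℝ → ℝ}
    (hh : ∀ s, 0 < s → h s =
      k * (mellinBarnes (foxKernel α 1 b₁ b₂) γ (A * s ^ (-(2 * α)))).re) :
    rlKernel 1 α h t =
      k * (t ^ (1 - α) * (mellinBarnes (foxKernel α (2 - α) b₁ b₂) γ (A * t ^ (-(2 * α)))).re) := by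
  have hK := isMellinBarnesKernel_foxKernel hα0 hα1 1 b₁ b₂
  have hα : α ≠ ((1 : ℕ) : ℝ) := by simpa using hα1.ne
  have hint := (integrable_mellinBarnes_mul_sub_rpow hα0 hα1 hK hγ hγ0 hA ht).integral_prod_left
  simp only [integral_mul_const] at hint
  have hcomm := Complex.reCLM.intervalIntegral_comp_comm (a := 0) (b := t)
    (intervalIntegrable_iff.2 hint)
  have heq := integral_mellinBarnes_foxKernel_mul_sub_rpow hα0 hα1 hγ hγ0 hA ht
  simp only [mellinBarnes] at heq
  rw [heq, ← Complex.ofReal_mul, Complex.reCLM_apply, Complex.re_ofReal_mul] at hcomm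
  have hΓ : Real.Gamma (1 - α) ≠ 0 := (Real.Gamma_pos_of_pos (sub_pos.2 hα1)).ne'
  have hmain : ∫ s in (0 : ℝ)..t, h s * (t - s) ^ (((1 : ℕ) : ℝ) - α - 1) =
      k * (Real.Gamma (1 - α) * t ^ (1 - α) *
        (mellinBarnes (foxKernel α (2 - α) b₁ b₂) γ (A * t ^ (-(2 * α)))).re) := by
    simp only [mellinBarnes]
    rw [← hcomm, ← intervalIntegral.integral_const_mul]
    refine intervalIntegral.integral_congr_ae (.of_forall fun s hs => ?_)
    rw [uIoc_of_le ht.le] at hs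
    rw [hh s hs.1, Complex.reCLM_apply, Complex.re_mul_ofReal, mellinBarnes,
      show ((1 : ℕ) : ℝ) - α - 1 = -α by push_cast; ring, mul_assoc]
  rw [rlKernel, if_neg hα]
  rw [hmain, Nat.cast_one]
  field_simp

theorem hasDerivAt_rpow_mul_mellinBarnes_time {α : ℝ} (hα0 : 0 < α) (hα1 : α < 1)
    {b₁ b₂ γ A t : ℝ} (hγ : γ < min b₁ b₂)
    (hA : 0 < A) (ht : 0 < t) :
    HasDerivAt (fun t : ℝ => t ^ (1 - α) *
        (mellinBarnes (foxKernel α (2 - α) b₁ b₂) γ (A * t ^ (-(2 * α)))).re)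
      (t ^ (-α) * (mellinBarnes (foxKernel α (1 - α) b₁ b₂) γ (A * t ^ (-(2 * α)))).re) t := by
  have hK := isMellinBarnesKernel_foxKernel hα0 hα1 (2 - α) b₁ b₂
  set w := A * t ^ (-(2 * α)) with hwdef
  have hw : 0 < w := mul_pos hA (Real.rpow_pos_of_pos ht _)
  have hM : HasDerivAt (fun w => (mellinBarnes (foxKernel α (2 - α) b₁ b₂) γ w).re)
      (w⁻¹ * (mellinBarnes (fun σ => σ * foxKernel α (2 - α) b₁ b₂ σ) γ w).re) w := by
    have := Complex.reCLM.hasFDerivAt.comp_hasDerivAt w (hK.hasDerivAt_mellinBarnes hγ hw)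
    rw [← Complex.ofReal_inv] at this
    simpa only [Complex.reCLM_apply, Complex.re_ofReal_mul] using! this
  have hin : HasDerivAt (fun t : ℝ => A * t ^ (-(2 * α))) (-(2 * α) * w / t) t := by
    have := (Real.hasDerivAt_rpow_const (x := t) (p := -(2 * α)) (Or.inl ht.ne')).const_mul A
    rw [Real.rpow_sub_one ht.ne'] at this
    convert! this using 1
    rw [hwdef]
    ring
  have hpow : HasDerivAt (fun t : ℝ => t ^ (1 - α)) ((1 - α) * t ^ (-α)) t := by
    have := Real.hasDerivAt_rpow_const (x := t) (p := 1 - α) (Or.inl ht.ne')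
    rwa [show 1 - α - 1 = -α by ring] at this
  have hlin : mellinBarnes (foxKernel α (1 - α) b₁ b₂) γ w =
      ((1 - α : ℝ) : ℂ) * mellinBarnes (foxKernel α (2 - α) b₁ b₂) γ w +
        ((-(2 * α) : ℝ) : ℂ) * mellinBarnes (fun σ => σ * foxKernel α (2 - α) b₁ b₂ σ) γ w := by
    rw [← hK.mellinBarnes_linear hK.id_mul hγ hw]
    congr 1 with σ
    rw [foxKernel_eq_mul_foxKernel_add_one, show 1 - α + 1 = 2 - α by ring]
    push_cast
    ring
  convert! hpow.mul (hM.comp t hin) using 1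
  simp only [Function.comp]
  rw [← hwdef, hlin, Complex.add_re, Complex.re_ofReal_mul, Complex.re_ofReal_mul,
    show 1 - α = -α + 1 by ring, Real.rpow_add_one ht.ne']
  field_simp

theorem rlDeriv_mellinBarnes_foxKernel {α : ℝ} (hα0 : 0 < α) (hα1 : α < 1)
    {b₁ b₂ γ γ₀ A t : ℝ} (hγ : γ < min b₁ b₂)
    (hγ₀ : γ₀ < min b₁ b₂) (hA : 0 < A) (ht : 0 < t) (k : ℝ) {h : ℝ → ℝ}
    (hh : ∀ s, 0 < s → h s =
      k * (mellinBarnes (foxKernel α 1 b₁ b₂) γ (A * s ^ (-(2 * α)))).re) :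
    rlDeriv 1 α h t =
      k * (t ^ (-α) *
        (mellinBarnes (foxKernel α (1 - α) b₁ b₂) γ₀ (A * t ^ (-(2 * α)))).re) := by
  set η := min γ 0
  have hη : η < min b₁ b₂ := (min_le_left _ _).trans_lt hγ
  have hpos : ∀ s : ℝ, 0 < s → 0 < A * s ^ (-(2 * α)) := fun s hs =>
    mul_pos hA (Real.rpow_pos_of_pos hs _)
  have hker : (rlKernel 1 α h) =ᶠ[nhds t] fun t => k * (t ^ (1 - α) *
      (mellinBarnes (foxKernel α (2 - α) b₁ b₂) η (A * t ^ (-(2 * α)))).re) := by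
    filter_upwards [Ioi_mem_nhds ht] with r hr
    refine rlKernel_mellinBarnes_foxKernel hα0 hα1 hη (min_le_right _ _) hA hr k fun s hs => ?_
    rw [hh s hs, (isMellinBarnesKernel_foxKernel hα0 hα1 1 b₁ b₂).mellinBarnes_eq hγ hη
      (hpos s hs)]
  rw [rlDeriv, iteratedDeriv_one, hker.deriv_eq,
    ((hasDerivAt_rpow_mul_mellinBarnes_time hα0 hα1 hη hA ht).const_mul k).deriv,
    (isMellinBarnesKernel_foxKernel hα0 hα1 (1 - α) b₁ b₂).mellinBarnes_eq hη hγ₀ (hpos t ht)]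

theorem rpow_neg_inv_mul_rpow {α y s : ℝ} (hα : α ≠ 0) (hy : 0 < y) (hs : 0 < s) :
    (y ^ (-(1 / α)) * s) ^ (-(2 * α)) / 4 = y ^ 2 / 4 * s ^ (-(2 * α)) := by
  rw [Real.mul_rpow (by positivity) hs.le, ← Real.rpow_mul hy.le,
    show -(1 / α) * -(2 * α) = ((2 : ℕ) : ℝ) by field_simp; norm_num, Real.rpow_natCast]
  ring

theorem sq_div_four_mul_rpow {α y s : ℝ} (hs : 0 < s) :
    y ^ 2 / 4 * s ^ (-(2 * α)) = y ^ 2 * (s ^ (-α)) ^ 2 / 4 := by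
  rw [← Real.rpow_natCast (s ^ (-α)) 2, ← Real.rpow_mul hs.le,
    show -α * ((2 : ℕ) : ℝ) = -(2 * α) by push_cast; ring]
  ring

theorem hasDerivAt_integral_inv_sqrt_add_const {I : Set ℝ} (hI : IsOpen I) (hIc : I.OrdConnected)
    {f : ℝ → ℝ} (hfpos : ∀ x ∈ I, 0 < f x) (hf : ContinuousOn f I) {β x : ℝ} (hβ : β ∈ I)
    (hx : x ∈ I) (k : ℝ) :
    HasDerivAt (fun x => (∫ r in β..x, (Real.sqrt (f r))⁻¹) + k) (Real.sqrt (f x))⁻¹ x := by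
  have hc : ContinuousOn (fun r => (Real.sqrt (f r))⁻¹) I :=
    hf.sqrt.inv₀ fun r hr => (Real.sqrt_pos.2 (hfpos r hr)).ne'
  exact (intervalIntegral.integral_hasDerivAt_right
    ((hc.mono (hIc.uIcc_subset hβ hx)).intervalIntegrable)
    (hc.stronglyMeasurableAtFilter hI x hx) (hc.continuousAt (hI.mem_nhds hx))).add_const k

/-- For `0 < α < 1`, the Fox-H invariant solutions (Case 1, item 1)
of the time-fractional telegraph system with `g = λ₂ √f / ω_{λ₁} + f'/2`. -/
theorem foxH_invariant_solutions_case1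
    (α : ℝ) (hα0 : 0 < α) (hα1 : α < 1)
    (I : Set ℝ) (hI : IsOpen I) (hIc : I.OrdConnected)
    (f : ℝ → ℝ) (hfpos : ∀ x ∈ I, 0 < f x) (hfs : ContDiffOn ℝ (⊤ : ℕ∞) f I)
    (β : ℝ) (hβ : β ∈ I) (lam₁ lam₂ : ℝ) (hlam₂ : lam₂ ≠ 0)
    (ω : ℝ → ℝ) (hω : ∀ x, ω x = (∫ r in β..x, (Real.sqrt (f r))⁻¹) + lam₁)
    (hωpos : ∀ x ∈ I, 0 < ω x)
    (g : ℝ → ℝ)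
    (hg : ∀ x ∈ I, g x = lam₂ * Real.sqrt (f x) / ω x + deriv f x / 2)
    (a c : ℝ) (γ₁ γ₂ : ℝ)
    (hγ₁ : γ₁ < min (1 / 2 - a / 2) (-(a + lam₂) / 2))
    (hγ₂ : γ₂ < min (-a / 2) (1 / 2 - (a + lam₂) / 2))
    (φ ψ : ℝ → ℝ)
    (hφ : ∀ z, φ z = foxH2012 α (1 / 2 - a / 2) (-(a + lam₂) / 2) γ₁
      (z ^ (-(2 * α)) / 4))
    (hψ : ∀ z, ψ z = foxH2012 α (-a / 2) (1 / 2 - (a + lam₂) / 2) γ₂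
      (z ^ (-(2 * α)) / 4))
    (u v : ℝ → ℝ → ℝ)
    (hu : ∀ x t, u x t = c / Real.sqrt (f x) * ω x ^ a * φ (ω x ^ (-(1 / α)) * t))
    (hv : ∀ x t, v x t = -c * ω x ^ a * ψ (ω x ^ (-(1 / α)) * t)) :
    ∀ x ∈ I, ∀ t ∈ Set.Ioi (0:ℝ),
      rlDeriv 1 α (fun s => u x s) t = deriv (fun y => v y t) x ∧
      rlDeriv 1 α (fun s => v x s) t
        = f x * deriv (fun y => u y t) x + g x * u x t := by
  intro x hx t ht
  rw [Set.mem_Ioi] at ht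
  have hα : α ≠ 0 := hα0.ne'
  have hy := hωpos x hx
  have hr : 0 < √(f x) := Real.sqrt_pos.2 (hfpos x hx)
  have hr2 : √(f x) ^ 2 = f x := Real.sq_sqrt (hfpos x hx).le
  have hωd : HasDerivAt ω (√(f x))⁻¹ x := by
    rw [funext hω]
    exact hasDerivAt_integral_inv_sqrt_add_const hI hIc hfpos hfs.continuousOn hβ hx lam₁
  have hfd : HasDerivAt f (deriv f x) x :=
    ((hfs.differentiableOn (by simp)).differentiableAt (hI.mem_nhds hx)).hasDerivAt
  have hτ : 0 < t ^ (-α) := Real.rpow_pos_of_pos ht _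
  have hφ' : ∀ y, 0 < y → ∀ s, 0 < s → φ (y ^ (-(1 / α)) * s) = 1 / (2 * π) *
      (mellinBarnes (foxKernel α 1 (1 / 2 - a / 2) (-(a + lam₂) / 2)) γ₁
        (y ^ 2 / 4 * s ^ (-(2 * α)))).re := fun y hy s hs => by
    rw [hφ, foxH2012_eq, rpow_neg_inv_mul_rpow hα hy hs]
  have hψ' : ∀ y, 0 < y → ∀ s, 0 < s → ψ (y ^ (-(1 / α)) * s) = 1 / (2 * π) *
      (mellinBarnes (foxKernel α 1 (-a / 2) (1 / 2 - (a + lam₂) / 2)) γ₂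
        (y ^ 2 / 4 * s ^ (-(2 * α)))).re := fun y hy s hs => by
    rw [hψ, foxH2012_eq, rpow_neg_inv_mul_rpow hα hy hs]
  have hA : 0 < ω x ^ 2 / 4 := by positivity
  have hIx : ∀ᶠ y in nhds x, y ∈ I := hI.mem_nhds hx
  constructor
  · rw [rlDeriv_mellinBarnes_foxKernel hα0 hα1 hγ₁ hγ₁ hA ht
      (c / √(f x) * ω x ^ a * (1 / (2 * π))) fun s hs => by rw [hu, hφ' _ hy s hs]; ring]
    have hY := (hasDerivAt_rpow_mul_mellinBarnes_foxKernel hα0 hα1 hγ₂ (γ₀ := γ₁)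
      (by
        rwa [show -a / 2 + 1 / 2 = 1 / 2 - a / 2 by ring,
          show 1 / 2 - (a + lam₂) / 2 - 1 / 2 = -(a + lam₂) / 2 by ring]) hτ hy).comp x hωd
    have hv' : (fun y => v y t) =ᶠ[nhds x] fun y => -c * (1 / (2 * π)) *
        ((fun y : ℝ => y ^ (-2 * (-a / 2)) * (mellinBarnes (foxKernel α 1 (-a / 2)
          (1 / 2 - (a + lam₂) / 2)) γ₂ (y ^ 2 * (t ^ (-α)) ^ 2 / 4)).re) ∘ ω) y := by
      filter_upwards [hIx] with y hy
      rw [hv, hψ' _ (hωpos y hy) t ht, Function.comp, sq_div_four_mul_rpow ht,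
        show -2 * (-a / 2) = a by ring]
      ring
    rw [hv'.deriv_eq, (hY.const_mul _).deriv, sq_div_four_mul_rpow ht,
      show -2 * (-a / 2) = a by ring, show -a / 2 + 1 / 2 = 1 / 2 - a / 2 by ring,
      show 1 / 2 - (a + lam₂) / 2 - 1 / 2 = -(a + lam₂) / 2 by ring]
    field_simp
  · rw [rlDeriv_mellinBarnes_foxKernel hα0 hα1 hγ₂ hγ₂ hA ht
      (-c * ω x ^ a * (1 / (2 * π))) fun s hs => by rw [hv, hψ' _ hy s hs]; ring]
    have hY := (hasDerivAt_rpow_mul_mellinBarnes_foxKernel hα0 hα1 (p := -(a + lam₂) / 2)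
      (q := 1 / 2 - a / 2) (γ := γ₁) (γ₀ := γ₂) (by rwa [min_comm])
      (by
        rwa [min_comm, show 1 / 2 - a / 2 - 1 / 2 = -a / 2 by ring,
          show -(a + lam₂) / 2 + 1 / 2 = 1 / 2 - (a + lam₂) / 2 by ring]) hτ hy).comp x hωd
    have hpow : HasDerivAt (fun y => ω y ^ (-lam₂))
        ((√(f x))⁻¹ * -lam₂ * (ω x ^ (-lam₂) / ω x)) x := by
      have := hωd.rpow_const (p := -lam₂) (Or.inl hy.ne')
      rwa [Real.rpow_sub_one hy.ne'] at this
    have hsqrt := (hfd.sqrt (hfpos x hx).ne').fun_inv hr.ne'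
    have hu' : (fun y => u y t) =ᶠ[nhds x] fun y => c * (1 / (2 * π)) *
        ((√(f y))⁻¹ * ω y ^ (-lam₂) * ((fun y : ℝ => y ^ (-2 * (-(a + lam₂) / 2)) *
          (mellinBarnes (foxKernel α 1 (-(a + lam₂) / 2) (1 / 2 - a / 2)) γ₁
            (y ^ 2 * (t ^ (-α)) ^ 2 / 4)).re) ∘ ω) y) := by
      filter_upwards [hIx] with y hy
      rw [hu, hφ' _ (hωpos y hy) t ht, Function.comp, sq_div_four_mul_rpow ht, foxKernel_comm,
        show ω y ^ a = ω y ^ (-lam₂) * ω y ^ (-2 * (-(a + lam₂) / 2)) by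
          rw [← Real.rpow_add (hωpos y hy)]; congr 1; ring]
      ring
    rw [hu'.deriv_eq, (((hsqrt.fun_mul hpow).fun_mul hY).const_mul _).deriv, hu'.eq_of_nhds,
      hg x hx, sq_div_four_mul_rpow ht, Function.comp,
      show -(a + lam₂) / 2 + 1 / 2 = 1 / 2 - (a + lam₂) / 2 by ring,
      show 1 / 2 - a / 2 - 1 / 2 = -a / 2 by ring,
      foxKernel_comm α (1 - α) (1 / 2 - (a + lam₂) / 2),
      show ω x ^ a = ω x ^ (-lam₂) * ω x ^ (-2 * (-(a + lam₂) / 2)) by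
        rw [← Real.rpow_add hy]; congr 1; ring]
    generalize (mellinBarnes _ _ _).re = M
    generalize (mellinBarnes _ _ _).re = N
    generalize ω x ^ (-2 * (-(a + lam₂) / 2)) = P
    generalize ω x ^ (-lam₂) = Q
    rw [← hr2]
    simp only [Real.sqrt_sq hr.le]
    field_simp
    ring
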